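/- arXiv:2505.15964 — 3 statements merged into one kernel-verified Lean document; each statement's English description precedes it below -/
import Mathlib

section
/- Let m = 1 and n ≥ 2, and let ξ ∈ ℝ^{n×1} be totally irrational with best approximation sequences (X_i), (L_i). If sup_{i≥1} L_i/L_{i+1} < ∞ (Property (C)), then the ordinary exponent satisfies ω(ξ) ≤ 1. -/
open Filter

/-- The sup-norm of the `i`-th integer vector `x i`, viewed in `ℝ^m`. -/
noncomputable def Xval {m : ℕ} (x : ℕ → Fin m → ℤ) (i : ℕ) : ℝ :=
  ‖(fun j => (x i j : ℝ))‖

/-- The sup-norm of the remainder `ξ 𝒙ᵢ − 𝒚ᵢ`. -/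
noncomputable def Lval {m n : ℕ} (ξ : Matrix (Fin n) (Fin m) ℝ)
    (x : ℕ → Fin m → ℤ) (y : ℕ → Fin n → ℤ) (i : ℕ) : ℝ :=
  ‖(ξ.mulVec (fun j => (x i j : ℝ)) - (fun k => (y i k : ℝ)))‖

/-- `ξ` is totally irrational: `‖ξ𝒙 − 𝒚‖ > 0` for every nonzero integer pair `(𝒙,𝒚)`. -/
def TotallyIrrational {m n : ℕ} (ξ : Matrix (Fin n) (Fin m) ℝ) : Prop :=
  ∀ (u : Fin m → ℤ) (v : Fin n → ℤ), (u, v) ≠ 0 →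
    0 < ‖(ξ.mulVec (fun j => (u j : ℝ)) - (fun k => (v k : ℝ)))‖

/-- `(𝒙ᵢ, 𝒚ᵢ)_{i}` is a sequence of best approximation vectors for `ξ`
(with respect to the sup norms). -/
structure IsBestApproxSeq {m n : ℕ} (ξ : Matrix (Fin n) (Fin m) ℝ)
    (x : ℕ → Fin m → ℤ) (y : ℕ → Fin n → ℤ) : Prop where
  nonzero : ∀ i, x i ≠ 0
  first : Xval x 0 = 1
  xStrictMono : StrictMono (Xval x)
  lStrictAnti : StrictAnti (Lval ξ x y)
  best : ∀ (i : ℕ) (u : Fin m → ℤ) (v : Fin n → ℤ), u ≠ 0 →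
    ‖(fun j => (u j : ℝ))‖ < Xval x (i + 1) →
    Lval ξ x y i ≤ ‖(ξ.mulVec (fun j => (u j : ℝ)) - (fun k => (v k : ℝ)))‖

/-- Property (A): `ξ` is badly approximable. -/
def PropA {m n : ℕ} (ξ : Matrix (Fin n) (Fin m) ℝ) : Prop :=
  ∃ c : ℝ, 0 < c ∧ ∀ (u : Fin m → ℤ) (v : Fin n → ℤ), u ≠ 0 →
    c ≤ ‖(fun j => (u j : ℝ))‖ ^ m *
        ‖(ξ.mulVec (fun j => (u j : ℝ)) - (fun k => (v k : ℝ)))‖ ^ n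

/-- Property (B): the ratios `X_{i+1}/X_i` are bounded. -/
def PropB {m : ℕ} (x : ℕ → Fin m → ℤ) : Prop :=
  ∃ M : ℝ, ∀ i : ℕ, Xval x (i + 1) / Xval x i ≤ M

/-- Property (C): the ratios `L_i/L_{i+1}` are bounded. -/
def PropC {m n : ℕ} (ξ : Matrix (Fin n) (Fin m) ℝ)
    (x : ℕ → Fin m → ℤ) (y : ℕ → Fin n → ℤ) : Prop :=
  ∃ M : ℝ, ∀ i : ℕ, Lval ξ x y i / Lval ξ x y (i + 1) ≤ M

/-- The ordinary exponent `ω(ξ) = limsup (−log Lᵢ)/(log Xᵢ)`, as a value in `[0,+∞]`. -/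
noncomputable def ordExp {m n : ℕ} (ξ : Matrix (Fin n) (Fin m) ℝ)
    (x : ℕ → Fin m → ℤ) (y : ℕ → Fin n → ℤ) : EReal :=
  limsup (fun i => ((-Real.log (Lval ξ x y i) / Real.log (Xval x i) : ℝ) : EReal)) atTop

/-- The uniform exponent `ω̂(ξ) = liminf (−log Lᵢ)/(log X_{i+1})`, as a value in `[0,+∞]`. -/
noncomputable def unifExp {m n : ℕ} (ξ : Matrix (Fin n) (Fin m) ℝ)
    (x : ℕ → Fin m → ℤ) (y : ℕ → Fin n → ℤ) : EReal :=
  liminf (fun i => ((-Real.log (Lval ξ x y i) / Real.log (Xval x (i + 1)) : ℝ) : EReal)) atTop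

theorem Xval_eq_abs (x : ℕ → Fin 1 → ℤ) (i : ℕ) : Xval x i = |(x i 0 : ℝ)| := by
  refine le_antisymm ?_ ?_
  · refine (pi_norm_le_iff_of_nonneg (abs_nonneg _)).2 fun j => ?_
    rw [Subsingleton.elim j 0, Real.norm_eq_abs]
  · simpa [Xval] using norm_le_pi_norm (fun j => (x i j : ℝ)) 0

theorem abs_sub_le_Lval {n : ℕ} (ξ : Matrix (Fin n) (Fin 1) ℝ) (x : ℕ → Fin 1 → ℤ)
    (y : ℕ → Fin n → ℤ) (i : ℕ) (k : Fin n) :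
    |ξ k 0 * x i 0 - y i k| ≤ Lval ξ x y i := by
  simpa [Lval, Matrix.mulVec, dotProduct] using
    norm_le_pi_norm (ξ.mulVec (fun j => (x i j : ℝ)) - (fun k => (y i k : ℝ))) k

/-- Two rational points with the same direction have proportional remainders. -/
theorem mul_Lval_le_of_minors_eq_zero {n : ℕ} (ξ : Matrix (Fin n) (Fin 1) ℝ)
    (x : ℕ → Fin 1 → ℤ) (y : ℕ → Fin n → ℤ) (i j : ℕ)
    (h : ∀ k, x i 0 * y j k = x j 0 * y i k) :
    |(x j 0 : ℝ)| * Lval ξ x y i ≤ |(x i 0 : ℝ)| * Lval ξ x y j := by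
  have hvec : (x j 0 : ℝ) • (ξ.mulVec (fun l => (x i l : ℝ)) - (fun k => (y i k : ℝ))) =
      (x i 0 : ℝ) • (ξ.mulVec (fun l => (x j l : ℝ)) - (fun k => (y j k : ℝ))) := by
    ext k
    have hk : (x i 0 : ℝ) * y j k = x j 0 * y i k := by exact_mod_cast h k
    simp only [Matrix.mulVec, dotProduct, Pi.smul_apply, Pi.sub_apply, smul_eq_mul,
      Fin.sum_univ_one]
    linear_combination hk
  have := congrArg norm hvec
  rw [norm_smul, norm_smul] at this
  exact this.le

namespace IsBestApproxSeq

variable {n : ℕ} {ξ : Matrix (Fin n) (Fin 1) ℝ} {x : ℕ → Fin 1 → ℤ} {y : ℕ → Fin n → ℤ}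

theorem Lval_pos (h : IsBestApproxSeq ξ x y) (i : ℕ) : 0 < Lval ξ x y i :=
  (norm_nonneg _).trans_lt (h.lStrictAnti (Nat.lt_succ_self i))

theorem add_one_le_Xval (h : IsBestApproxSeq ξ x y) (i : ℕ) : (i : ℝ) + 1 ≤ Xval x i := by
  induction i with
  | zero => simp [h.first]
  | succ i ih =>
    have hlt := h.xStrictMono (Nat.lt_succ_self i)
    rw [Xval_eq_abs, Nat.succ_eq_add_one] at hlt
    rw [Xval_eq_abs] at hlt ih ⊢
    have hle : |x i 0| + 1 ≤ |x (i + 1) 0| := by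
      have : |x i 0| < |x (i + 1) 0| := by exact_mod_cast hlt
      omega
    have : |(x i 0 : ℝ)| + 1 ≤ |(x (i + 1) 0 : ℝ)| := by exact_mod_cast hle
    push_cast
    linarith

theorem tendsto_Xval (h : IsBestApproxSeq ξ x y) : Tendsto (Xval x) atTop atTop :=
  tendsto_atTop_mono (fun i => (le_add_of_nonneg_right zero_le_one).trans (h.add_one_le_Xval i))
    tendsto_natCast_atTop_atTop

/-- Consecutive best approximations are linearly independent, so some `2 × 2` minor is a nonzero
integer. -/
theorem one_le_two_mul_Xval_mul_Lval (h : IsBestApproxSeq ξ x y) (i : ℕ) :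
    1 ≤ 2 * Xval x (i + 1) * Lval ξ x y i := by
  have hX : Xval x i < Xval x (i + 1) := h.xStrictMono (Nat.lt_succ_self i)
  have hL : Lval ξ x y (i + 1) < Lval ξ x y i := h.lStrictAnti (Nat.lt_succ_self i)
  have hL1 := h.Lval_pos (i + 1)
  have hX0 : 0 ≤ Xval x i := norm_nonneg _
  obtain ⟨k, hk⟩ : ∃ k, x i 0 * y (i + 1) k ≠ x (i + 1) 0 * y i k := by
    by_contra! hall
    have hle := mul_Lval_le_of_minors_eq_zero ξ x y i (i + 1) hall
    rw [← Xval_eq_abs, ← Xval_eq_abs] at hle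
    nlinarith
  have hint : (1 : ℝ) ≤ |(x i 0 : ℝ) * y (i + 1) k - x (i + 1) 0 * y i k| := by
    exact_mod_cast Int.one_le_abs (sub_ne_zero.2 hk)
  have hsplit : (x i 0 : ℝ) * y (i + 1) k - x (i + 1) 0 * y i k =
      x (i + 1) 0 * (ξ k 0 * x i 0 - y i k) -
        x i 0 * (ξ k 0 * x (i + 1) 0 - y (i + 1) k) := by ring
  calc (1 : ℝ) ≤ _ := hint
    _ ≤ |(x (i + 1) 0 : ℝ)| * |ξ k 0 * x i 0 - y i k| +
        |(x i 0 : ℝ)| * |ξ k 0 * x (i + 1) 0 - y (i + 1) k| := by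
      rw [hsplit, ← abs_mul, ← abs_mul]
      exact abs_sub _ _
    _ ≤ Xval x (i + 1) * Lval ξ x y i + Xval x (i + 1) * Lval ξ x y i := by
      rw [← Xval_eq_abs, ← Xval_eq_abs]
      have h1 := abs_sub_le_Lval ξ x y i k
      have h2 := (abs_sub_le_Lval ξ x y (i + 1) k).trans hL.le
      have hX1 := hX0.trans hX.le
      gcongr
    _ = _ := by ring

end IsBestApproxSeq

/-- For `m = 1, n ≥ 2`: property (C) implies `ω(ξ) ≤ 1`. -/
theorem stmt_12 (n : ℕ) (hn : 2 ≤ n)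
    (ξ : Matrix (Fin n) (Fin 1) ℝ) (hirr : TotallyIrrational ξ)
    (x : ℕ → Fin 1 → ℤ) (y : ℕ → Fin n → ℤ) (hxy : IsBestApproxSeq ξ x y)
    (hC : PropC ξ x y) :
    ordExp ξ x y ≤ (1 : EReal) := by
  obtain ⟨M, hM⟩ := hC
  have hM0 : 0 < M := (div_pos (hxy.Lval_pos 0) (hxy.Lval_pos 1)).trans_le (hM 0)
  have hlog : Tendsto (fun i => Real.log (Xval x i)) atTop atTop :=
    Real.tendsto_log_atTop.comp hxy.tendsto_Xval
  have hlim : Tendsto (fun i => ((1 + Real.log (2 * M) / Real.log (Xval x i) : ℝ) : EReal))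
      atTop (nhds ((1 : ℝ) : EReal)) := by
    refine (continuous_coe_real_ereal.tendsto 1).comp ?_
    simpa using (hlog.const_div_atTop (Real.log (2 * M))).const_add 1
  have hbound : ∀ᶠ i in atTop,
      ((-Real.log (Lval ξ x y i) / Real.log (Xval x i) : ℝ) : EReal) ≤
        ((1 + Real.log (2 * M) / Real.log (Xval x i) : ℝ) : EReal) := by
    filter_upwards [hlog.eventually_gt_atTop 0, eventually_ge_atTop 1] with i hi h1
    obtain ⟨i, rfl⟩ := Nat.exists_eq_add_of_le' h1
    have hL := hxy.Lval_pos (i + 1)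
    have hX : 0 < Xval x (i + 1) :=
      (by positivity : (0 : ℝ) < ((i + 1 : ℕ) : ℝ) + 1).trans_le (hxy.add_one_le_Xval (i + 1))
    have hprod : 1 ≤ 2 * M * (Xval x (i + 1) * Lval ξ x y (i + 1)) :=
      calc (1 : ℝ) ≤ 2 * Xval x (i + 1) * Lval ξ x y i := hxy.one_le_two_mul_Xval_mul_Lval i
        _ ≤ 2 * Xval x (i + 1) * (M * Lval ξ x y (i + 1)) := by
          gcongr
          exact (div_le_iff₀ hL).1 (hM i)
        _ = _ := by ring
    have hsum := Real.log_nonneg hprod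
    rw [Real.log_mul (by positivity) (by positivity), Real.log_mul hX.ne' hL.ne'] at hsum
    rw [EReal.coe_le_coe_iff, div_le_iff₀ hi, add_mul, div_mul_cancel₀ _ hi.ne']
    linarith
  calc ordExp ξ x y ≤ _ := limsup_le_limsup hbound
    _ = 1 := by rw [hlim.limsup_eq, EReal.coe_one]
end

section
/- Let m ≥ 3 and n ≥ 2, and let ξ ∈ ℝ^{n×m} be totally irrational with best approximation sequences (X_i), (L_i). If sup_{i≥1} L_i/L_{i+1} < ∞ (Property (C)), then the ordinary exponent is finite: ω(ξ) < ∞. -/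
open Filter

theorem IsBestApproxSeq.one_le_Xval {m n : ℕ} {ξ : Matrix (Fin n) (Fin m) ℝ}
    {x : ℕ → Fin m → ℤ} {y : ℕ → Fin n → ℤ} (hxy : IsBestApproxSeq ξ x y) (i : ℕ) :
    1 ≤ Xval x i :=
  hxy.first ▸ hxy.xStrictMono.monotone (Nat.zero_le i)

theorem TotallyIrrational.Lval_pos {m n : ℕ} {ξ : Matrix (Fin n) (Fin m) ℝ}
    (hirr : TotallyIrrational ξ) {x : ℕ → Fin m → ℤ} (y : ℕ → Fin n → ℤ) {i : ℕ}
    (hx : x i ≠ 0) : 0 < Lval ξ x y i :=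
  hirr (x i) (y i) fun h => hx (Prod.ext_iff.mp h).1

/-- If two best approximation vectors are congruent modulo `3`, their norms differ by a factor
of at least `3 / 2`. -/
theorem IsBestApproxSeq.Xval_le_of_congr {m n : ℕ} {ξ : Matrix (Fin n) (Fin m) ℝ}
    {x : ℕ → Fin m → ℤ} {y : ℕ → Fin n → ℤ} (hirr : TotallyIrrational ξ)
    (hxy : IsBestApproxSeq ξ x y) {a b : ℕ} (hab : a < b)
    (hx : ∀ j, (3 : ℤ) ∣ x b j - x a j) (hy : ∀ k, (3 : ℤ) ∣ y b k - y a k) :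
    3 / 2 * Xval x a ≤ Xval x b := by
  choose u hu using hx
  choose v hv using hy
  have hu' : (fun j => (u j : ℝ)) =
      (1 / 3 : ℝ) • ((fun j => (x b j : ℝ)) - (fun j => (x a j : ℝ))) := by
    funext j
    have h : (x b j : ℝ) - x a j = 3 * u j := by exact_mod_cast hu j
    simp [h]
  have hv' : (fun k => (v k : ℝ)) =
      (1 / 3 : ℝ) • ((fun k => (y b k : ℝ)) - (fun k => (y a k : ℝ))) := by
    funext k
    have h : (y b k : ℝ) - y a k = 3 * v k := by exact_mod_cast hv k
    simp [h]
  have hXab := hxy.xStrictMono hab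
  have hLab := hxy.lStrictAnti hab
  have hLb := hirr.Lval_pos y (hxy.nonzero b)
  have hu0 : u ≠ 0 := by
    rintro rfl
    have h : x b = x a := by
      funext j
      have := hu j
      simp only [Pi.zero_apply, mul_zero] at this
      linarith
    simp [Xval, h] at hXab
  have hXu : ‖(fun j => (u j : ℝ))‖ ≤ 1 / 3 * (Xval x b + Xval x a) := by
    rw [hu', norm_smul, Real.norm_of_nonneg (by norm_num)]
    exact mul_le_mul_of_nonneg_left (norm_sub_le _ _) (by norm_num)
  have hLu : ‖ξ.mulVec (fun j => (u j : ℝ)) - (fun k => (v k : ℝ))‖ ≤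
      1 / 3 * (Lval ξ x y b + Lval ξ x y a) := by
    rw [hu', hv', Matrix.mulVec_smul, Matrix.mulVec_sub, ← smul_sub, sub_sub_sub_comm, norm_smul,
      Real.norm_of_nonneg (by norm_num)]
    exact mul_le_mul_of_nonneg_left (norm_sub_le _ _) (by norm_num)
  have hXa := hxy.xStrictMono (Nat.lt_succ_self a)
  by_contra! hlt
  have := hxy.best a u v hu0 (by
    have : Xval x a < Xval x (a + 1) := hXa
    linarith)
  linarith

/-- The norms of best approximation vectors grow at least geometrically. -/
theorem IsBestApproxSeq.exists_Xval_add_ge {m n : ℕ} {ξ : Matrix (Fin n) (Fin m) ℝ}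
    {x : ℕ → Fin m → ℤ} {y : ℕ → Fin n → ℤ} (hirr : TotallyIrrational ξ)
    (hxy : IsBestApproxSeq ξ x y) :
    ∃ K : ℕ, 0 < K ∧ ∀ i, 3 / 2 * Xval x i ≤ Xval x (i + K) := by
  refine ⟨Fintype.card ((Fin m → ZMod 3) × (Fin n → ZMod 3)), Fintype.card_pos, fun i => ?_⟩
  set K := Fintype.card ((Fin m → ZMod 3) × (Fin n → ZMod 3)) with hK
  let f : Fin (K + 1) → (Fin m → ZMod 3) × (Fin n → ZMod 3) := fun t =>
    (fun j => (x (i + t) j : ZMod 3), fun k => (y (i + t) k : ZMod 3))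
  obtain ⟨s, t, hst, hf⟩ : ∃ s t, s ≠ t ∧ f s = f t :=
    Fintype.exists_ne_map_eq_of_card_lt f (by simp [← hK])
  wlog hlt : s < t generalizing s t
  · exact this t s hst.symm hf.symm (lt_of_le_of_ne (not_lt.mp hlt) hst.symm)
  obtain ⟨hfx, hfy⟩ := Prod.ext_iff.mp hf
  have key := hxy.Xval_le_of_congr hirr (a := i + s) (b := i + t)
    (Nat.add_lt_add_left hlt i)
    (fun j => (ZMod.intCast_eq_intCast_iff_dvd_sub _ _ 3).mp (congrFun hfx j))
    (fun k => (ZMod.intCast_eq_intCast_iff_dvd_sub _ _ 3).mp (congrFun hfy k))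
  have h1 : Xval x i ≤ Xval x (i + s) := hxy.xStrictMono.monotone (Nat.le_add_right _ _)
  have h2 : Xval x (i + t) ≤ Xval x (i + K) :=
    hxy.xStrictMono.monotone (Nat.add_le_add_left (Nat.lt_succ_iff.mp t.2) i)
  linarith

/-- Under property (C) the approximation errors decay at most geometrically. -/
theorem PropC.exists_neg_log_Lval_le {m n : ℕ} {ξ : Matrix (Fin n) (Fin m) ℝ}
    {x : ℕ → Fin m → ℤ} {y : ℕ → Fin n → ℤ} (hC : PropC ξ x y)
    (hL : ∀ i, 0 < Lval ξ x y i) :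
    ∃ B : ℝ, 0 ≤ B ∧ ∀ i : ℕ, -Real.log (Lval ξ x y i) ≤ (i + 1) * B := by
  obtain ⟨M, hM⟩ := hC
  refine ⟨|Real.log M| + |Real.log (Lval ξ x y 0)|, by positivity, fun i => ?_⟩
  induction i with
  | zero =>
    have := neg_le_abs (Real.log (Lval ξ x y 0))
    have := abs_nonneg (Real.log M)
    norm_num
    linarith
  | succ i ih =>
    have h := Real.log_le_log (div_pos (hL i) (hL (i + 1))) (hM i)
    rw [Real.log_div (hL i).ne' (hL (i + 1)).ne'] at h
    have := le_abs_self (Real.log M)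
    have := abs_nonneg (Real.log (Lval ξ x y 0))
    push_cast
    linarith

/-- For `m ≥ 3, n ≥ 2`: property (C) implies `ω(ξ) < ∞`. -/
theorem stmt_14 (m n : ℕ) (hm : 3 ≤ m) (hn : 2 ≤ n)
    (ξ : Matrix (Fin n) (Fin m) ℝ) (hirr : TotallyIrrational ξ)
    (x : ℕ → Fin m → ℤ) (y : ℕ → Fin n → ℤ) (hxy : IsBestApproxSeq ξ x y)
    (hC : PropC ξ x y) :
    ordExp ξ x y < (⊤ : EReal) := by
  obtain ⟨K, hK, hX⟩ := hxy.exists_Xval_add_ge hirr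
  obtain ⟨B, hB, hL⟩ := hC.exists_neg_log_Lval_le fun i => hirr.Lval_pos y (hxy.nonzero i)
  have hlog : 0 < Real.log (3 / 2) := Real.log_pos (by norm_num)
  have hgrowth (q : ℕ) : q * Real.log (3 / 2) ≤ Real.log (Xval x (K * q)) := by
    induction q with
    | zero => simpa using Real.log_nonneg (hxy.one_le_Xval 0)
    | succ q ih =>
      have hpos : 0 < Xval x (K * q) := zero_lt_one.trans_le (hxy.one_le_Xval _)
      have h := Real.log_le_log (by positivity) (hX (K * q))
      rw [Real.log_mul (by norm_num) hpos.ne', ← Nat.mul_succ] at h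
      push_cast
      linarith
  have hbound : ∀ i, K ≤ i →
      -Real.log (Lval ξ x y i) / Real.log (Xval x i) ≤ 2 * K * B / Real.log (3 / 2) := by
    intro i hi
    have hq : 1 ≤ i / K := (Nat.one_le_div_iff hK).mpr hi
    have hiq : i + 1 ≤ 2 * K * (i / K) := by
      have h1 := Nat.div_add_mod i K
      have h2 := Nat.mod_lt i hK
      nlinarith
    have hiq' : (i + 1 : ℝ) ≤ 2 * K * (i / K : ℕ) := by exact_mod_cast hiq
    have hXi : (i / K : ℕ) * Real.log (3 / 2) ≤ Real.log (Xval x i) :=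
      (hgrowth _).trans (Real.log_le_log (zero_lt_one.trans_le (hxy.one_le_Xval _))
        (hxy.xStrictMono.monotone (Nat.mul_div_le i K)))
    have hqpos : (0 : ℝ) < (i / K : ℕ) := by exact_mod_cast hq
    rw [div_le_div_iff₀ ((mul_pos hqpos hlog).trans_le hXi) hlog]
    calc -Real.log (Lval ξ x y i) * Real.log (3 / 2)
        ≤ 2 * K * (i / K : ℕ) * B * Real.log (3 / 2) := by
          gcongr
          exact (hL i).trans (by gcongr)
      _ = 2 * K * B * ((i / K : ℕ) * Real.log (3 / 2)) := by ring
      _ ≤ 2 * K * B * Real.log (Xval x i) := by gcongr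
  have hev : ∀ᶠ i in atTop, ((-Real.log (Lval ξ x y i) / Real.log (Xval x i) : ℝ) : EReal) ≤
      ((2 * K * B / Real.log (3 / 2) : ℝ) : EReal) := by
    filter_upwards [eventually_ge_atTop K] with i hi
    exact EReal.coe_le_coe_iff.mpr (hbound i hi)
  exact (limsup_le_of_le (by isBoundedDefault) hev).trans_lt (EReal.coe_lt_top _)
end

section
/- Let m = 2 and n ≥ 2, and let ξ ∈ ℝ^{n×2} be totally irrational. Let (𝒙_i,𝒚_i)_{i≥1} be a sequence of best approximation vectors for ξ with respect to the Euclidean norms, with X_i = ‖𝒙_i‖₂ and L_i = ‖ξ𝒙_i − 𝒚_i‖₂, and suppose there is M ≥ 1 such that X_{i+1}/X_i ≤ M and L_i/L_{i+1} ≤ M for all i ≥ 1. Then there exists a constant C > 0, depending only on M and ξ, such that for all indices ν < k, if all the vectors (𝒙_ν,𝒚_ν), (𝒙_{ν+1},𝒚_{ν+1}), …, (𝒙_k,𝒚_k) lie in a common two-dimensional linear subspace of ℝ^{2+n}, then L_ν · X_{ν+1} ≤ C · L_{k−1} · X_k. -/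
open Filter

/-- `N` is a norm on `ℝ^k`. -/
def IsNorm {k : ℕ} (N : (Fin k → ℝ) → ℝ) : Prop :=
  (∀ v, 0 ≤ N v) ∧ (∀ v, N v = 0 ↔ v = 0) ∧
  (∀ (c : ℝ) (v : Fin k → ℝ), N (c • v) = |c| * N v) ∧
  (∀ v w, N (v + w) ≤ N v + N w)

/-- `(𝒙ᵢ, 𝒚ᵢ)_{i}` is a sequence of best approximation vectors for `ξ` with
respect to the pair of norms `N₁` (on `ℝ^m`) and `N₂` (on `ℝ^n`). -/
structure IsBestApproxSeqWith {m n : ℕ} (ξ : Matrix (Fin n) (Fin m) ℝ)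
    (N₁ : (Fin m → ℝ) → ℝ) (N₂ : (Fin n → ℝ) → ℝ)
    (x : ℕ → Fin m → ℤ) (y : ℕ → Fin n → ℤ) : Prop where
  nonzero : ∀ i, x i ≠ 0
  xStrictMono : StrictMono (fun i => N₁ (fun j => (x i j : ℝ)))
  lStrictAnti : StrictAnti
    (fun i => N₂ (ξ.mulVec (fun j => (x i j : ℝ)) - (fun k => (y i k : ℝ))))
  best : ∀ (i : ℕ) (u : Fin m → ℤ) (v : Fin n → ℤ), u ≠ 0 →
    N₁ (fun j => (u j : ℝ)) < N₁ (fun j => (x (i + 1) j : ℝ)) →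
    N₂ (ξ.mulVec (fun j => (x i j : ℝ)) - (fun k => (y i k : ℝ))) ≤
      N₂ (ξ.mulVec (fun j => (u j : ℝ)) - (fun k => (v k : ℝ)))

/-- The Euclidean norm on `ℝ^k`. -/
noncomputable def eNorm {k : ℕ} (v : Fin k → ℝ) : ℝ := Real.sqrt (∑ j, v j ^ 2)

/-- The Euclidean norm of the `i`-th integer vector `x i`. -/
noncomputable def eXval {m : ℕ} (x : ℕ → Fin m → ℤ) (i : ℕ) : ℝ :=
  eNorm (fun j => (x i j : ℝ))

/-- The Euclidean norm of the remainder `ξ 𝒙ᵢ − 𝒚ᵢ`. -/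
noncomputable def eLval {m n : ℕ} (ξ : Matrix (Fin n) (Fin m) ℝ)
    (x : ℕ → Fin m → ℤ) (y : ℕ → Fin n → ℤ) (i : ℕ) : ℝ :=
  eNorm (ξ.mulVec (fun j => (x i j : ℝ)) - (fun k => (y i k : ℝ)))

section Wedge

variable {V W : Type*} [NormedAddCommGroup V] [InnerProductSpace ℝ V]
  [NormedAddCommGroup W] [InnerProductSpace ℝ W]

/-- The squared Hilbert-Schmidt norm of the antisymmetrised tensor of two pairs of vectors. -/
noncomputable def wedgeSq (x x' : V) (r r' : W) : ℝ :=
  ‖x‖ ^ 2 * ‖r'‖ ^ 2 + ‖x'‖ ^ 2 * ‖r‖ ^ 2 - 2 * inner ℝ x x' * inner ℝ r r'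

lemma norm_smul_add_smul_sq (x x' : V) (p q : ℝ) :
    ‖p • x + q • x'‖ ^ 2 = p ^ 2 * ‖x‖ ^ 2 + 2 * (p * q * inner ℝ x x') + q ^ 2 * ‖x'‖ ^ 2 := by
  rw [norm_add_sq_real, norm_smul, norm_smul, real_inner_smul_left, real_inner_smul_right,
    mul_pow, mul_pow, Real.norm_eq_abs, Real.norm_eq_abs, sq_abs, sq_abs]
  ring

lemma inner_smul_add_smul (x x' : V) (p q p' q' : ℝ) :
    inner ℝ (p • x + q • x') (p' • x + q' • x') =
      p * p' * ‖x‖ ^ 2 + (p * q' + p' * q) * inner ℝ x x' + q * q' * ‖x'‖ ^ 2 := by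
  simp only [inner_add_left, inner_add_right, real_inner_smul_left, real_inner_smul_right,
    real_inner_self_eq_norm_sq, real_inner_comm x x']
  ring

lemma wedgeSq_smul_add_smul (x x' : V) (r r' : W) (p q p' q' : ℝ) :
    wedgeSq (p • x + q • x') (p' • x + q' • x') (p • r + q • r') (p' • r + q' • r') =
      (p * q' - p' * q) ^ 2 * wedgeSq x x' r r' := by
  simp only [wedgeSq, norm_smul_add_smul_sq, inner_smul_add_smul]
  ring

lemma wedgeSq_le {x x' : V} {r r' : W} (hx : ‖x‖ ≤ ‖x'‖) (hr : ‖r'‖ ≤ ‖r‖) :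
    wedgeSq x x' r r' ≤ 4 * (‖r‖ * ‖x'‖) ^ 2 := by
  have h1 : |inner ℝ x x' * inner ℝ r r'| ≤ (‖x‖ * ‖x'‖) * (‖r‖ * ‖r'‖) := by
    rw [abs_mul]
    exact mul_le_mul (abs_real_inner_le_norm _ _) (abs_real_inner_le_norm _ _)
      (abs_nonneg _) (by positivity)
  have h2 : ‖x‖ * ‖r'‖ ≤ ‖x'‖ * ‖r‖ := by gcongr
  have h3 : 0 ≤ ‖x‖ * ‖r'‖ := by positivity
  unfold wedgeSq
  nlinarith [neg_abs_le (inner ℝ x x' * inner ℝ r r')]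

lemma le_wedgeSq_of_inner_nonneg {x x' : V} {r r' : W} (hx : ‖x‖ ≤ ‖x'‖) (hr : ‖r'‖ ≤ ‖r‖)
    (hxx : 0 ≤ inner ℝ x x') (hsub : ‖x' - x‖ < ‖x'‖ → ‖r‖ ≤ ‖r' - r‖) :
    3 / 4 * (‖r‖ * ‖x'‖) ^ 2 ≤ wedgeSq x x' r r' := by
  have hX := norm_nonneg x
  have hX' := norm_nonneg x'
  have hR := norm_nonneg r
  have hR' := norm_nonneg r'
  have hcx := real_inner_le_norm x x'
  have hcr := real_inner_le_norm r r'
  have hnx := norm_sub_sq_real x' x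
  have hnr := norm_sub_sq_real r' r
  rw [real_inner_comm] at hnx hnr
  unfold wedgeSq
  rcases le_or_gt (inner ℝ r r') 0 with hrr | hrr
  · nlinarith [mul_nonneg hxx (neg_nonneg.2 hrr), sq_nonneg (‖x‖ * ‖r'‖), sq_nonneg (‖r‖ * ‖x'‖)]
  rcases lt_or_ge ‖x' - x‖ ‖x'‖ with h | h
  · have h1 : 2 * inner ℝ r r' ≤ ‖r'‖ ^ 2 := by
      nlinarith [pow_le_pow_left₀ hR (hsub h) 2]
    have h2 : inner ℝ x x' * (2 * inner ℝ r r') ≤ (‖x‖ * ‖x'‖) * ‖r'‖ ^ 2 :=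
      mul_le_mul hcx h1 (by positivity) (by positivity)
    have h3 : ‖x'‖ ^ 2 * ‖r'‖ ^ 2 ≤ ‖x'‖ ^ 2 * ‖r‖ ^ 2 := by gcongr
    nlinarith [sq_nonneg ((‖x‖ - ‖x'‖ / 2) * ‖r'‖)]
  · have h1 : 2 * inner ℝ x x' ≤ ‖x‖ ^ 2 := by
      nlinarith [pow_le_pow_left₀ hX' h 2]
    have h2 : (2 * inner ℝ x x') * inner ℝ r r' ≤ (‖x‖ * ‖x'‖) * (‖r‖ * ‖r'‖) :=
      mul_le_mul (by nlinarith) hcr hrr.le (by positivity)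
    nlinarith [sq_nonneg (‖x‖ * ‖r'‖ - ‖x'‖ * ‖r‖ / 2)]

lemma le_wedgeSq {x x' : V} {r r' : W} (hx : ‖x‖ ≤ ‖x'‖) (hr : ‖r'‖ ≤ ‖r‖)
    (hsub : ‖x' - x‖ < ‖x'‖ → ‖r‖ ≤ ‖r' - r‖) (hadd : ‖x' + x‖ < ‖x'‖ → ‖r‖ ≤ ‖r' + r‖) :
    3 / 4 * (‖r‖ * ‖x'‖) ^ 2 ≤ wedgeSq x x' r r' := by
  rcases le_total 0 (inner ℝ x x') with h | h
  · exact le_wedgeSq_of_inner_nonneg hx hr h hsub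
  · have := le_wedgeSq_of_inner_nonneg (x := -x) (x' := x') (r := -r) (r' := r')
      (by simpa using hx) (by simpa using hr) (by simpa using h) (by simpa using hadd)
    simpa [wedgeSq] using this

end Wedge

/-- Simultaneous Dirichlet approximation of two real numbers. -/
lemma exists_simultaneous_approx (α β : ℝ) {Q : ℕ} (hQ : 0 < Q) :
    ∃ j : ℕ, 0 < j ∧ j ≤ Q ^ 2 ∧ ∃ p q : ℤ, |j * α - p| < 1 / Q ∧ |j * β - q| < 1 / Q := by
  have hQ' : (0 : ℝ) < Q := by exact_mod_cast hQ
  let box (γ : ℝ) (j : ℕ) : ℕ := ⌊Q * Int.fract (j * γ)⌋₊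
  have box_lt (γ : ℝ) (j : ℕ) : box γ j < Q := by
    rw [Nat.floor_lt (by positivity)]
    nlinarith [Int.fract_lt_one (j * γ)]
  have box_eq {γ : ℝ} {i j : ℕ} (hij : i ≤ j) (h : box γ i = box γ j) :
      |((j - i : ℕ) : ℝ) * γ - ((⌊j * γ⌋ - ⌊i * γ⌋ : ℤ) : ℝ)| < 1 / Q := by
    have h1 := Nat.floor_le (a := Q * Int.fract (i * γ)) (by positivity)
    have h2 := Nat.lt_floor_add_one (Q * Int.fract (i * γ))
    have h3 := Nat.floor_le (a := Q * Int.fract (j * γ)) (by positivity)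
    have h4 := Nat.lt_floor_add_one (Q * Int.fract (j * γ))
    have h' : ((⌊Q * Int.fract (i * γ)⌋₊ : ℕ) : ℝ) = (⌊Q * Int.fract (j * γ)⌋₊ : ℕ) := by
      exact_mod_cast h
    have e : ((j - i : ℕ) : ℝ) * γ - ((⌊j * γ⌋ - ⌊i * γ⌋ : ℤ) : ℝ) =
        Int.fract (j * γ) - Int.fract (i * γ) := by
      push_cast [Int.fract, Nat.cast_sub hij]
      ring
    rw [e, abs_lt, neg_lt, neg_sub, lt_div_iff₀ hQ', lt_div_iff₀ hQ']
    constructor <;> linarith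
  obtain ⟨i, hi, j, hj, hij, he⟩ := Finset.exists_ne_map_eq_of_card_lt_of_maps_to
    (s := Finset.range (Q ^ 2 + 1)) (t := Finset.range Q ×ˢ Finset.range Q)
    (f := fun j => (box α j, box β j)) (by simp [sq])
    (fun j _ => by simp [box_lt])
  wlog hlt : i < j generalizing i j
  · exact this j hj i hi hij.symm he.symm (by omega)
  rw [Finset.mem_range] at hj
  rw [Prod.mk.injEq] at he
  exact ⟨j - i, by omega, by omega, _, _, box_eq hlt.le he.1, box_eq hlt.le he.2⟩

section Lattice

variable {Λ V W : Type*} [AddCommGroup Λ] [NormedAddCommGroup V] [InnerProductSpace ℝ V]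
  [NormedAddCommGroup W] [InnerProductSpace ℝ W]

lemma norm_smul_add_smul_lt {u v : V} {s t ε R : ℝ} (hR : 0 < R) (hu : ‖u‖ ≤ R) (hv : ‖v‖ ≤ R)
    (hs : |s| < ε) (ht : |t| < ε) : ‖s • u + t • v‖ < 2 * R * ε := by
  calc _ ≤ |s| * ‖u‖ + |t| * ‖v‖ := by
        simpa only [norm_smul, Real.norm_eq_abs] using norm_add_le (s • u) (t • v)
    _ ≤ |s| * R + |t| * R := by gcongr
    _ < ε * R + ε * R := by gcongr
    _ = _ := by ring

lemma map_nsmul_sub_combination (h : Λ →+ V) {a b c : Λ} {α β : ℝ}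
    (hc : h c = α • h a + β • h b) {j : ℕ} {p q : ℤ} :
    h (j • c - (p • a + q • b)) = (j * α - p) • h a + (j * β - q) • h b := by
  simp only [map_sub, map_add, map_nsmul, map_zsmul, hc]
  simp only [← Nat.cast_smul_eq_nsmul ℝ, ← Int.cast_smul_eq_zsmul ℝ]
  module

lemma natCast_smul_map_eq (h : Λ →+ V) {a b c : Λ} {j : ℕ} {p q : ℤ}
    (hc : j • c = p • a + q • b) : (j : ℝ) • h c = (p : ℝ) • h a + (q : ℝ) • h b := by
  simp only [Nat.cast_smul_eq_nsmul, Int.cast_smul_eq_zsmul, ← map_nsmul, ← map_zsmul,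
    ← map_add, hc]

/-- A lattice point in the real span of `a, b` has a bounded multiple in their integer span,
provided the cylinder determined by `‖f b‖` and `‖g a‖` contains no lattice point off the
kernel of `f`. -/
lemma exists_nsmul_eq_zsmul_add_zsmul (f : Λ →+ V) (g : Λ →+ W) {a b c : Λ} {Q : ℕ} (hQ : 2 ≤ Q)
    (hgQ : 2 * ‖g a‖ ≤ Q) (hfb : 0 < ‖f b‖) (hga : 0 < ‖g a‖)
    (hf : ‖f a‖ ≤ ‖f b‖) (hg : ‖g b‖ ≤ ‖g a‖)
    (hker : ∀ u, f u = 0 → u ≠ 0 → 1 ≤ ‖g u‖)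
    (hbest : ∀ u, f u ≠ 0 → ‖f u‖ < ‖f b‖ → ‖g a‖ ≤ ‖g u‖)
    {α β : ℝ} (hfc : f c = α • f a + β • f b) (hgc : g c = α • g a + β • g b) :
    ∃ j : ℕ, 0 < j ∧ j ≤ Q ^ 2 ∧ ∃ p q : ℤ, j • c = p • a + q • b := by
  obtain ⟨j, hj, hjQ, p, q, hp, hq⟩ := exists_simultaneous_approx α β (by omega : 0 < Q)
  refine ⟨j, hj, hjQ, p, q, ?_⟩
  have hQ' : (2 : ℝ) ≤ Q := by exact_mod_cast hQ
  have hfu := norm_smul_add_smul_lt hfb hf le_rfl hp hq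
  have hgu := norm_smul_add_smul_lt hga le_rfl hg hp hq
  rw [mul_one_div, ← map_nsmul_sub_combination f hfc] at hfu
  rw [mul_one_div, ← map_nsmul_sub_combination g hgc] at hgu
  by_contra hne
  have hu : j • c - (p • a + q • b) ≠ 0 := sub_ne_zero.2 hne
  by_cases h0 : f (j • c - (p • a + q • b)) = 0
  · refine (hker _ h0 hu).not_gt (hgu.trans_le ?_)
    rw [div_le_one (by linarith)]
    exact hgQ
  · refine (hbest _ h0 (hfu.trans_le ?_)).not_gt (hgu.trans_le ?_) <;>
    · rw [div_le_iff₀ (by linarith)]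
      nlinarith

/-- Two pairs `a, b` and `c, d` of consecutive minimal points spanning the same plane have
comparable values of `‖g a‖ * ‖f b‖`. -/
lemma norm_mul_norm_le_of_common_plane (f : Λ →+ V) (g : Λ →+ W) {a b c d : Λ} {Q : ℕ}
    (hQ : 2 ≤ Q) (hgQ : 2 * ‖g a‖ ≤ Q) (hfb : 0 < ‖f b‖) (hga : 0 < ‖g a‖)
    (hf : ‖f a‖ ≤ ‖f b‖) (hg : ‖g b‖ ≤ ‖g a‖) (hf' : ‖f c‖ ≤ ‖f d‖) (hg' : ‖g d‖ ≤ ‖g c‖)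
    (hker : ∀ u, f u = 0 → u ≠ 0 → 1 ≤ ‖g u‖)
    (hbest : ∀ u, f u ≠ 0 → ‖f u‖ < ‖f b‖ → ‖g a‖ ≤ ‖g u‖)
    (hw : 3 / 4 * (‖g a‖ * ‖f b‖) ^ 2 ≤ wedgeSq (f a) (f b) (g a) (g b))
    (hw' : 0 < wedgeSq (f c) (f d) (g c) (g d))
    (hc : ∃ α β : ℝ, f c = α • f a + β • f b ∧ g c = α • g a + β • g b)
    (hd : ∃ α β : ℝ, f d = α • f a + β • f b ∧ g d = α • g a + β • g b) :
    ‖g a‖ * ‖f b‖ ≤ 4 * (Q : ℝ) ^ 4 * ‖g c‖ * ‖f d‖ := by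
  obtain ⟨α, β, hfc, hgc⟩ := hc
  obtain ⟨γ, δ, hfd, hgd⟩ := hd
  obtain ⟨i, hi, hiQ, p, q, hic⟩ :=
    exists_nsmul_eq_zsmul_add_zsmul f g hQ hgQ hfb hga hf hg hker hbest hfc hgc
  obtain ⟨j, hj, hjQ, p', q', hjd⟩ :=
    exists_nsmul_eq_zsmul_add_zsmul f g hQ hgQ hfb hga hf hg hker hbest hfd hgd
  have key : ((i : ℝ) * j) ^ 2 * wedgeSq (f c) (f d) (g c) (g d) =
      ((p : ℝ) * q' - p' * q) ^ 2 * wedgeSq (f a) (f b) (g a) (g b) := by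
    rw [← wedgeSq_smul_add_smul, ← natCast_smul_map_eq f hic, ← natCast_smul_map_eq f hjd,
      ← natCast_smul_map_eq g hic, ← natCast_smul_map_eq g hjd]
    simpa using (wedgeSq_smul_add_smul (f c) (f d) (g c) (g d) i 0 0 j).symm
  have hij : 0 < (i : ℝ) * j := by positivity
  have hdet : (1 : ℝ) ≤ ((p : ℝ) * q' - p' * q) ^ 2 := by
    have : p * q' - p' * q ≠ 0 := by
      intro h0
      have h0' : (p : ℝ) * q' - p' * q = 0 := by exact_mod_cast h0
      rw [h0'] at key
      have : 0 < ((i : ℝ) * j) ^ 2 * wedgeSq (f c) (f d) (g c) (g d) := by positivity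
      linarith
    have : 1 ≤ (p * q' - p' * q) ^ 2 := by
      have := sq_pos_of_ne_zero this
      omega
    exact_mod_cast this
  have hijQ : (i : ℝ) * j ≤ (Q : ℝ) ^ 4 := by
    have : i * j ≤ Q ^ 4 := by
      calc i * j ≤ Q ^ 2 * Q ^ 2 := Nat.mul_le_mul hiQ hjQ
        _ = Q ^ 4 := by ring
    exact_mod_cast this
  have hup := wedgeSq_le hf' hg'
  have hab : 0 ≤ wedgeSq (f a) (f b) (g a) (g b) := le_trans (by positivity) hw
  refine le_of_sq_le_sq ?_ (by positivity)
  have h1 : 3 / 4 * (‖g a‖ * ‖f b‖) ^ 2 ≤ ((Q : ℝ) ^ 4) ^ 2 * (4 * (‖g c‖ * ‖f d‖) ^ 2) := by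
    calc _ ≤ 1 * wedgeSq (f a) (f b) (g a) (g b) := by linarith
      _ ≤ ((p : ℝ) * q' - p' * q) ^ 2 * wedgeSq (f a) (f b) (g a) (g b) := by gcongr
      _ = ((i : ℝ) * j) ^ 2 * wedgeSq (f c) (f d) (g c) (g d) := key.symm
      _ ≤ _ := by gcongr
  have h2 : 0 ≤ ((Q : ℝ) ^ 4) ^ 2 * (‖g c‖ * ‖f d‖) ^ 2 := by positivity
  linarith [show (4 * (Q : ℝ) ^ 4 * ‖g c‖ * ‖f d‖) ^ 2 =
    16 * (((Q : ℝ) ^ 4) ^ 2 * (‖g c‖ * ‖f d‖) ^ 2) by ring]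

end Lattice

lemma eNorm_eq_norm_toLp {k : ℕ} (v : Fin k → ℝ) : eNorm v = ‖WithLp.toLp 2 v‖ := by
  simp [eNorm, EuclideanSpace.norm_eq]

lemma one_le_eNorm_intCast {k : ℕ} {v : Fin k → ℤ} (hv : v ≠ 0) :
    1 ≤ eNorm (fun j => (v j : ℝ)) := by
  obtain ⟨j, hj⟩ := Function.ne_iff.1 hv
  rw [eNorm, Real.one_le_sqrt]
  have h1 : (1 : ℝ) ≤ (v j : ℝ) ^ 2 := by
    have : 0 < v j ^ 2 := sq_pos_of_ne_zero hj
    exact_mod_cast this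
  exact h1.trans (Finset.single_le_sum (f := fun j => (v j : ℝ) ^ 2)
    (fun _ _ => sq_nonneg _) (Finset.mem_univ j))

/-- The first component of an integer vector, as a point of Euclidean space. -/
noncomputable def xPart (m n : ℕ) :
    (Fin m → ℤ) × (Fin n → ℤ) →+ EuclideanSpace ℝ (Fin m) where
  toFun z := WithLp.toLp 2 (fun j => (z.1 j : ℝ))
  map_zero' := by ext; simp
  map_add' _ _ := by ext; simp

/-- The remainder `ξ 𝒙 − 𝒚` of an integer vector, as a point of Euclidean space. -/
noncomputable def remainder {m n : ℕ} (ξ : Matrix (Fin n) (Fin m) ℝ) :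
    (Fin m → ℤ) × (Fin n → ℤ) →+ EuclideanSpace ℝ (Fin n) where
  toFun z := WithLp.toLp 2 (ξ.mulVec (fun j => (z.1 j : ℝ)) - (fun k => (z.2 k : ℝ)))
  map_zero' := by ext; simp [Matrix.mulVec, dotProduct]
  map_add' _ _ := by
    ext
    simp [Matrix.mulVec, dotProduct, mul_add, Finset.sum_add_distrib]
    ring

section Best

variable {m n : ℕ}

lemma norm_xPart (z : (Fin m → ℤ) × (Fin n → ℤ)) :
    ‖xPart m n z‖ = eNorm (fun j => (z.1 j : ℝ)) := (eNorm_eq_norm_toLp _).symm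

lemma norm_remainder (ξ : Matrix (Fin n) (Fin m) ℝ) (z : (Fin m → ℤ) × (Fin n → ℤ)) :
    ‖remainder ξ z‖ = eNorm (ξ.mulVec (fun j => (z.1 j : ℝ)) - (fun k => (z.2 k : ℝ))) :=
  (eNorm_eq_norm_toLp _).symm

lemma xPart_eq_zero_iff {z : (Fin m → ℤ) × (Fin n → ℤ)} : xPart m n z = 0 ↔ z.1 = 0 := by
  constructor
  · intro h
    by_contra h0
    have := one_le_eNorm_intCast h0
    rw [← norm_xPart, h, norm_zero] at this
    linarith
  · intro h
    ext j
    simp [xPart, h]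

lemma one_le_norm_remainder (ξ : Matrix (Fin n) (Fin m) ℝ) {z : (Fin m → ℤ) × (Fin n → ℤ)}
    (hz : xPart m n z = 0) (hne : z ≠ 0) : 1 ≤ ‖remainder ξ z‖ := by
  rw [xPart_eq_zero_iff] at hz
  have h2 : z.2 ≠ 0 := fun h => hne (Prod.ext hz h)
  have := one_le_eNorm_intCast h2
  rw [norm_remainder, hz]
  simpa [eNorm, Matrix.mulVec, dotProduct] using this

lemma xPart_remainder_eq_of_eq (ξ : Matrix (Fin n) (Fin m) ℝ)
    {a b c : (Fin m → ℤ) × (Fin n → ℤ)} {α β : ℝ}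
    (h : α • ((fun j => (a.1 j : ℝ)), (fun l => (a.2 l : ℝ))) +
      β • ((fun j => (b.1 j : ℝ)), (fun l => (b.2 l : ℝ))) =
      ((fun j => (c.1 j : ℝ)), (fun l => (c.2 l : ℝ)))) :
    xPart m n c = α • xPart m n a + β • xPart m n b ∧
      remainder ξ c = α • remainder ξ a + β • remainder ξ b := by
  obtain ⟨h1, h2⟩ := Prod.ext_iff.1 h
  simp only [Prod.fst_add, Prod.snd_add, Prod.smul_fst, Prod.smul_snd] at h1 h2
  constructor
  · simp only [xPart, AddMonoidHom.coe_mk, ZeroHom.coe_mk, ← h1, WithLp.toLp_add,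
      WithLp.toLp_smul]
  · simp only [remainder, AddMonoidHom.coe_mk, ZeroHom.coe_mk, ← h1, ← h2, Matrix.mulVec_add,
      Matrix.mulVec_smul, WithLp.toLp_add, WithLp.toLp_smul, WithLp.toLp_sub]
    module

lemma linearIndependent_of_wedgeSq_pos (ξ : Matrix (Fin n) (Fin m) ℝ)
    {a b : (Fin m → ℤ) × (Fin n → ℤ)}
    (h : 0 < wedgeSq (xPart m n a) (xPart m n b) (remainder ξ a) (remainder ξ b)) :
    LinearIndependent ℝ ![((fun j => (a.1 j : ℝ)), (fun l => (a.2 l : ℝ))),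
      ((fun j => (b.1 j : ℝ)), (fun l => (b.2 l : ℝ)))] := by
  rw [LinearIndependent.pair_iff]
  intro s t hst
  have h0 := xPart_remainder_eq_of_eq ξ (a := a) (b := b) (c := 0) (α := s) (β := t)
    (hst.trans (by ext <;> simp))
  simp only [map_zero] at h0
  have hs := wedgeSq_smul_add_smul (xPart m n a) (xPart m n b) (remainder ξ a) (remainder ξ b)
    s t 0 1
  have ht := wedgeSq_smul_add_smul (xPart m n a) (xPart m n b) (remainder ξ a) (remainder ξ b)
    s t 1 0
  rw [← h0.1, ← h0.2] at hs ht
  constructor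
  · exact (pow_eq_zero_iff two_ne_zero).1
      ((mul_eq_zero.1 (by simpa [wedgeSq] using hs.symm)).resolve_right h.ne')
  · exact (pow_eq_zero_iff two_ne_zero).1
      ((mul_eq_zero.1 (by simpa [wedgeSq] using ht.symm)).resolve_right h.ne')

namespace IsBestApproxSeqWith

variable {ξ : Matrix (Fin n) (Fin m) ℝ} {x : ℕ → Fin m → ℤ} {y : ℕ → Fin n → ℤ}

lemma eLval_pos (hxy : IsBestApproxSeqWith ξ eNorm eNorm x y) (i : ℕ) : 0 < eLval ξ x y i :=
  (Real.sqrt_nonneg _).trans_lt (hxy.lStrictAnti (Nat.lt_succ_self i))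

lemma eXval_pos (hxy : IsBestApproxSeqWith ξ eNorm eNorm x y) (i : ℕ) : 0 < eXval x i :=
  one_pos.trans_le (one_le_eNorm_intCast (hxy.nonzero i))

lemma norm_xPart_mono (hxy : IsBestApproxSeqWith ξ eNorm eNorm x y) (i : ℕ) :
    ‖xPart m n (x i, y i)‖ < ‖xPart m n (x (i + 1), y (i + 1))‖ := by
  simpa only [norm_xPart] using hxy.xStrictMono (Nat.lt_succ_self i)

lemma norm_remainder_anti (hxy : IsBestApproxSeqWith ξ eNorm eNorm x y) (i : ℕ) :
    ‖remainder ξ (x (i + 1), y (i + 1))‖ < ‖remainder ξ (x i, y i)‖ := by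
  simpa only [norm_remainder] using hxy.lStrictAnti (Nat.lt_succ_self i)

lemma norm_remainder_le (hxy : IsBestApproxSeqWith ξ eNorm eNorm x y) (i : ℕ)
    (u : (Fin m → ℤ) × (Fin n → ℤ)) (hu : xPart m n u ≠ 0)
    (hlt : ‖xPart m n u‖ < ‖xPart m n (x (i + 1), y (i + 1))‖) :
    ‖remainder ξ (x i, y i)‖ ≤ ‖remainder ξ u‖ := by
  simp only [norm_xPart, norm_remainder] at hlt ⊢
  exact hxy.best i u.1 u.2 (fun h => hu (xPart_eq_zero_iff.2 h)) hlt

lemma le_wedgeSq_succ (hxy : IsBestApproxSeqWith ξ eNorm eNorm x y) (i : ℕ) :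
    3 / 4 * (eLval ξ x y i * eXval x (i + 1)) ^ 2 ≤
      wedgeSq (xPart m n (x i, y i)) (xPart m n (x (i + 1), y (i + 1)))
        (remainder ξ (x i, y i)) (remainder ξ (x (i + 1), y (i + 1))) := by
  have hlt := hxy.norm_xPart_mono i
  have h := le_wedgeSq hlt.le (hxy.norm_remainder_anti i).le
    (fun h => by
      rw [← map_sub] at h ⊢
      refine hxy.norm_remainder_le i _ (fun h0 => ?_) h
      rw [map_sub, sub_eq_zero] at h0
      exact hlt.ne (by rw [h0]))
    (fun h => by
      rw [← map_add] at h ⊢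
      refine hxy.norm_remainder_le i _ (fun h0 => ?_) h
      rw [map_add, add_eq_zero_iff_eq_neg] at h0
      exact hlt.ne (by rw [h0, norm_neg]))
  rwa [norm_xPart, norm_remainder] at h

lemma wedgeSq_succ_pos (hxy : IsBestApproxSeqWith ξ eNorm eNorm x y) (i : ℕ) :
    0 < wedgeSq (xPart m n (x i, y i)) (xPart m n (x (i + 1), y (i + 1)))
        (remainder ξ (x i, y i)) (remainder ξ (x (i + 1), y (i + 1))) := by
  have h1 := hxy.eLval_pos i
  have h2 := hxy.eXval_pos (i + 1)
  exact lt_of_lt_of_le (by positivity) (hxy.le_wedgeSq_succ i)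

lemma eq_combination_of_mem_plane (hxy : IsBestApproxSeqWith ξ eNorm eNorm x y)
    {S : Submodule ℝ ((Fin m → ℝ) × (Fin n → ℝ))}
    (hS : Module.finrank ℝ S = 2) {i : ℕ}
    (hi : ((fun j => (x i j : ℝ)), (fun l => (y i l : ℝ))) ∈ S)
    (hi' : ((fun j => (x (i + 1) j : ℝ)), (fun l => (y (i + 1) l : ℝ))) ∈ S)
    {c : (Fin m → ℤ) × (Fin n → ℤ)}
    (hc : ((fun j => (c.1 j : ℝ)), (fun l => (c.2 l : ℝ))) ∈ S) :
    ∃ α β : ℝ, xPart m n c = α • xPart m n (x i, y i) + β • xPart m n (x (i + 1), y (i + 1)) ∧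
      remainder ξ c = α • remainder ξ (x i, y i) + β • remainder ξ (x (i + 1), y (i + 1)) := by
  have hli := linearIndependent_of_wedgeSq_pos ξ (hxy.wedgeSq_succ_pos i)
  have hspan := Submodule.eq_of_le_of_finrank_eq (Submodule.span_le.2 (Set.range_subset_iff.2
    (Fin.forall_fin_two.2 ⟨hi, hi'⟩))) ((finrank_span_eq_card hli).trans (by simp [hS]))
  rw [← hspan, Matrix.range_cons, Matrix.range_cons, Matrix.range_empty, Set.union_empty,
    Set.singleton_union, Submodule.mem_span_pair] at hc
  obtain ⟨α, β, h⟩ := hc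
  exact ⟨α, β, xPart_remainder_eq_of_eq ξ h⟩

end IsBestApproxSeqWith

end Best

/-- monotonicity lemma. For `m = 2, n ≥ 2`, Euclidean best
approximations with bounded ratios: if `𝒙_ν, …, 𝒙_k` lie in a common two-dimensional
linear subspace, then `L_ν X_{ν+1} ≤ C · L_{k−1} X_k` for a constant `C = C(M, ξ)`. -/
theorem stmt_19 (n : ℕ) (hn : 2 ≤ n)
    (ξ : Matrix (Fin n) (Fin 2) ℝ) (hirr : TotallyIrrational ξ)
    (x : ℕ → Fin 2 → ℤ) (y : ℕ → Fin n → ℤ)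
    (hxy : IsBestApproxSeqWith ξ eNorm eNorm x y)
    (M : ℝ) (hM : 1 ≤ M)
    (hB : ∀ i : ℕ, eXval x (i + 1) / eXval x i ≤ M)
    (hC : ∀ i : ℕ, eLval ξ x y i / eLval ξ x y (i + 1) ≤ M) :
    ∃ C : ℝ, 0 < C ∧ ∀ ν k : ℕ, ν < k →
      (∃ W : Submodule ℝ ((Fin 2 → ℝ) × (Fin n → ℝ)), Module.finrank ℝ W = 2 ∧
        ∀ i : ℕ, ν ≤ i → i ≤ k →
          ((fun j => (x i j : ℝ)), (fun l => (y i l : ℝ))) ∈ W) →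
      eLval ξ x y ν * eXval x (ν + 1) ≤ C * eLval ξ x y (k - 1) * eXval x k := by
  obtain ⟨N, hN⟩ := exists_nat_ge (2 * eLval ξ x y 0)
  refine ⟨4 * ((N + 2 : ℕ) : ℝ) ^ 4, by positivity, ?_⟩
  rintro ν k hνk ⟨S, hS, hmem⟩
  obtain ⟨k, rfl⟩ : ∃ l, k = l + 1 := ⟨k - 1, by omega⟩
  rw [Nat.add_sub_cancel]
  have hLν : eLval ξ x y ν ≤ eLval ξ x y 0 := hxy.lStrictAnti.antitone (Nat.zero_le ν)
  have hcomb (i : ℕ) (h1 : ν ≤ i) (h2 : i ≤ k + 1) :=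
    hxy.eq_combination_of_mem_plane hS (hmem ν le_rfl hνk.le) (hmem (ν + 1) (by omega) hνk)
      (c := (x i, y i)) (hmem i h1 h2)
  have hL (i : ℕ) : ‖remainder ξ (x i, y i)‖ = eLval ξ x y i := norm_remainder _ _
  have hX (i : ℕ) : ‖xPart 2 n (x i, y i)‖ = eXval x i := norm_xPart _
  have h := norm_mul_norm_le_of_common_plane (xPart 2 n) (remainder ξ) (Q := N + 2) (by omega)
    (by rw [hL]; push_cast; linarith) (by rw [hX]; exact hxy.eXval_pos _)
    (by rw [hL]; exact hxy.eLval_pos _)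
    (hxy.norm_xPart_mono ν).le (hxy.norm_remainder_anti ν).le
    (hxy.norm_xPart_mono k).le (hxy.norm_remainder_anti k).le
    (fun _ => one_le_norm_remainder ξ) (hxy.norm_remainder_le ν)
    (by rw [hL, hX]; exact hxy.le_wedgeSq_succ ν) (hxy.wedgeSq_succ_pos k)
    (hcomb k (by omega) (by omega)) (hcomb (k + 1) (by omega) le_rfl)
  simpa only [hL, hX] using h
end
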